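/- Let Λ be a compact metric space, f : Λ → Λ a homeomorphism, and S : Λ → 𝒮ⁿ continuous with ρ := sup_{x∈Λ} ‖Q S_x Q‖ < 1 (operator norm); write Ŝ_x := Q S_x Q and S^k_x := S_{f^{k−1}(x)}⋯S_x. Then there exists a unique continuous family of linear maps σ_x : N → ℝu (x ∈ Λ) such that S_x(σ_x(v) + v) = σ_{f(x)}(Ŝ_x v) + Ŝ_x v for all x ∈ Λ and all v ∈ N. Moreover, the subspaces F²_x := {σ_x(v) + v : v ∈ N} satisfy: dim F²_x = n − 1, ℝⁿ = ℝu ⊕ F²_x, S_x(F²_x) ⊆ F²_{f(x)}, and there exists C ≥ 1 such that ‖S^k_x w‖ ≤ C·ρ^k·‖w‖ for every x ∈ Λ, every k ∈ ℕ and every w ∈ F²_x. -/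

import Mathlib

open Matrix Filter Topology

/-- `S` is a row-stochastic matrix: all entries in `[0,1]` and each row sums to `1`. -/
def IsStochastic {n : ℕ} (S : Matrix (Fin n) (Fin n) ℝ) : Prop :=
  (∀ i j, 0 ≤ S i j ∧ S i j ≤ 1) ∧ ∀ i, ∑ j, S i j = 1

/-- The unit vector `u = (1/√n, …, 1/√n)`. -/
noncomputable def uvec (n : ℕ) : Fin n → ℝ := fun _ => 1 / Real.sqrt n

/-- The orthogonal projection onto the line `ℝu`, i.e. `(1/n)·J` with `J` the all-ones matrix. -/
noncomputable def Pmat (n : ℕ) : Matrix (Fin n) (Fin n) ℝ := Matrix.of fun _ _ => (1 : ℝ) / n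

/-- The orthogonal projection `Q = I − P` onto the hyperplane `N = {v : ∑ᵢ vᵢ = 0}`. -/
noncomputable def Qmat (n : ℕ) : Matrix (Fin n) (Fin n) ℝ := 1 - Pmat n

/-- `ℝⁿ` with the Euclidean norm. -/
noncomputable def toE {n : ℕ} (v : Fin n → ℝ) : EuclideanSpace ℝ (Fin n) :=
  (EuclideanSpace.equiv (Fin n) ℝ).symm v

/-- The operator norm of a matrix induced by the Euclidean norm on `ℝⁿ`. -/
noncomputable def opNorm {n : ℕ} (S : Matrix (Fin n) (Fin n) ℝ) : ℝ :=
  ‖LinearMap.toContinuousLinearMap (Matrix.toEuclideanLin S)‖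

/-- The hyperplane `N = {v ∈ ℝⁿ : ∑ᵢ vᵢ = 0}`. -/
noncomputable def Nhyp (n : ℕ) : Submodule ℝ (Fin n → ℝ) :=
  LinearMap.ker (∑ i : Fin n, (LinearMap.proj i : (Fin n → ℝ) →ₗ[ℝ] ℝ))

/-- Logarithm with values in `EReal`, with the convention `log 0 = −∞`. -/
noncomputable def elog (r : ℝ) : EReal := if r ≤ 0 then ⊥ else ((Real.log r : ℝ) : EReal)

/-- The cocycle iterates `S^k_x = S_{f^{k−1}(x)} ⋯ S_{f(x)} S_x`. -/
noncomputable def cocycle {n : ℕ} {X : Type*} (f : X → X) (S : X → Matrix (Fin n) (Fin n) ℝ) :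
    ℕ → X → Matrix (Fin n) (Fin n) ℝ
  | 0, _ => 1
  | k + 1, x => S (f^[k] x) * cocycle f S k x

/-- The ordered product `prodA S k = S_{k−1} ⋯ S_1 S_0`. -/
noncomputable def prodA {n : ℕ} (S : ℕ → Matrix (Fin n) (Fin n) ℝ) :
    ℕ → Matrix (Fin n) (Fin n) ℝ
  | 0 => 1
  | k + 1 => S k * prodA S k

section NormedRing

variable {Λ R : Type*} [NormedRing R]

/-- The twisted cohomological equation `φ x = φ (f x) * T x - b x` over a contraction `T` has a
continuous solution. -/
theorem exists_continuous_eq_comp_mul_sub [TopologicalSpace Λ] [CompactSpace Λ] [CompleteSpace R]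
    {f : Λ → Λ} (hf : Continuous f) {T b : Λ → R} (hT : Continuous T) (hb : Continuous b)
    {ρ : ℝ} (hρ : ρ < 1) (hTρ : ∀ x, ‖T x‖ ≤ ρ) :
    ∃ φ : Λ → R, Continuous φ ∧ ∀ x, φ x = φ (f x) * T x - b x := by
  let Φ : C(Λ, R) → C(Λ, R) := fun φ =>
    ⟨fun x => φ (f x) * T x - b x, by fun_prop⟩
  have hΦ : ContractingWith ρ.toNNReal Φ := by
    refine ⟨by simpa using hρ, LipschitzWith.of_dist_le_mul fun φ ψ => ?_⟩
    refine (ContinuousMap.dist_le (by positivity)).2 fun x => ?_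
    have hx : φ (f x) * T x - b x - (ψ (f x) * T x - b x) = (φ (f x) - ψ (f x)) * T x := by
      noncomm_ring
    calc dist (Φ φ x) (Φ ψ x) = ‖(φ (f x) - ψ (f x)) * T x‖ := by
          rw [dist_eq_norm]; exact congrArg norm hx
      _ ≤ ‖φ (f x) - ψ (f x)‖ * ‖T x‖ := norm_mul_le _ _
      _ ≤ dist φ ψ * ρ.toNNReal := by
          gcongr
          · rw [← dist_eq_norm]; exact ContinuousMap.dist_apply_le_dist _
          · exact (hTρ x).trans (Real.le_coe_toNNReal ρ)
      _ = ρ.toNNReal * dist φ ψ := mul_comm _ _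
  refine ⟨⇑(ContractingWith.fixedPoint Φ hΦ : C(Λ, R)), ContinuousMap.continuous _, fun x => ?_⟩
  exact (DFunLike.congr_fun hΦ.fixedPoint_isFixedPt x).symm

/-- A bounded solution of `δ x = δ (f x) * T x` over a contraction `T` vanishes. -/
theorem eq_zero_of_eq_comp_mul {f : Λ → Λ} {T δ : Λ → R} {ρ M : ℝ} (hρ : ρ < 1)
    (hTρ : ∀ x, ‖T x‖ ≤ ρ) (hM : ∀ x, ‖δ x‖ ≤ M) (hδ : ∀ x, δ x = δ (f x) * T x) (x : Λ) :
    δ x = 0 := by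
  have hρ0 : 0 ≤ ρ := (norm_nonneg _).trans (hTρ x)
  have hM0 : 0 ≤ M := (norm_nonneg _).trans (hM x)
  have key : ∀ k : ℕ, ∀ y, ‖δ y‖ ≤ M * ρ ^ k := by
    intro k
    induction k with
    | zero => simpa using hM
    | succ k ih =>
      intro y
      calc ‖δ y‖ ≤ ‖δ (f y)‖ * ‖T y‖ := by rw [hδ y]; exact norm_mul_le _ _
        _ ≤ M * ρ ^ k * ρ := by gcongr; exacts [ih _, hTρ y]
        _ = M * ρ ^ (k + 1) := by ring
  have hlim : Tendsto (fun k : ℕ => M * ρ ^ k) atTop (𝓝 0) := by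
    simpa using (tendsto_pow_atTop_nhds_zero_of_lt_one hρ0 hρ).const_mul M
  exact norm_le_zero_iff.1 (ge_of_tendsto' hlim fun k => key k x)

end NormedRing

section Projections

variable {n : ℕ}

theorem Pmat_mulVec (v : Fin n → ℝ) : Pmat n *ᵥ v = fun _ => (∑ i, v i) / n := by
  ext i
  simp [Pmat, mulVec, dotProduct, ← Finset.mul_sum, div_eq_inv_mul]

theorem mul_Pmat {M : Matrix (Fin n) (Fin n) ℝ} (hM : ∀ i, ∑ j, M i j = 1) :
    M * Pmat n = Pmat n := by
  ext i j
  simp [Pmat, Matrix.mul_apply, ← Finset.sum_mul, hM]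

theorem Pmat_mul_self : Pmat n * Pmat n = Pmat n := by
  refine mul_Pmat fun i => ?_
  have : (n : ℝ) ≠ 0 := by exact_mod_cast i.pos.ne'
  simp [Pmat, this]

theorem Pmat_mul_Qmat : Pmat n * Qmat n = 0 := by
  rw [Qmat, mul_sub, mul_one, Pmat_mul_self, sub_self]

theorem Qmat_mul_Pmat : Qmat n * Pmat n = 0 := by
  rw [Qmat, sub_mul, one_mul, Pmat_mul_self, sub_self]

theorem Qmat_mul_self : Qmat n * Qmat n = Qmat n := by
  nth_rw 1 [Qmat]
  rw [sub_mul, one_mul, Pmat_mul_Qmat, sub_zero]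

theorem compression_mul_Qmat (M : Matrix (Fin n) (Fin n) ℝ) :
    Qmat n * M * Qmat n * Qmat n = Qmat n * M * Qmat n := by
  rw [mul_assoc _ (Qmat n), Qmat_mul_self]

theorem Qmat_mul_compression (M : Matrix (Fin n) (Fin n) ℝ) :
    Qmat n * (Qmat n * M * Qmat n) = Qmat n * M * Qmat n := by
  rw [← mul_assoc, ← mul_assoc, Qmat_mul_self]

theorem mem_span_uvec {v : Fin n → ℝ} :
    v ∈ Submodule.span ℝ {uvec n} ↔ Pmat n *ᵥ v = v := by
  rcases Nat.eq_zero_or_pos n with rfl | hn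
  · rw [Subsingleton.elim v 0, mulVec_zero]
    exact iff_of_true (zero_mem _) rfl
  have hn' : (n : ℝ) ≠ 0 := by exact_mod_cast hn.ne'
  have hs : Real.sqrt n ≠ 0 := by positivity
  rw [Submodule.mem_span_singleton, Pmat_mulVec]
  constructor
  · rintro ⟨c, rfl⟩
    ext i
    simp [uvec]
    field_simp
  · intro h
    refine ⟨Real.sqrt n * ((∑ i, v i) / n), ?_⟩
    conv_rhs => rw [← h]
    ext i
    simp [uvec]
    field_simp

theorem mem_Nhyp {v : Fin n → ℝ} : v ∈ Nhyp n ↔ Qmat n *ᵥ v = v := by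
  rw [Qmat, sub_mulVec, one_mulVec, sub_eq_self, Pmat_mulVec]
  rcases Nat.eq_zero_or_pos n with rfl | hn
  · exact iff_of_true (by simp [Nhyp]) (Subsingleton.elim _ _)
  have hn' : (n : ℝ) ≠ 0 := by exact_mod_cast hn.ne'
  constructor
  · intro h
    have h' : ∑ i, v i = 0 := by simpa [Nhyp] using h
    ext i
    simp [h']
  · intro h
    have h' := congrFun h ⟨0, hn⟩
    simpa [Nhyp, hn'] using h'

theorem Qmat_mulVec_mem_Nhyp (v : Fin n → ℝ) : Qmat n *ᵥ v ∈ Nhyp n := by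
  rw [mem_Nhyp, mulVec_mulVec, Qmat_mul_self]

theorem Pmat_mul_eq_self_iff {A : Matrix (Fin n) (Fin n) ℝ} :
    Pmat n * A = A ↔ ∀ v, A *ᵥ v ∈ Submodule.span ℝ {uvec n} := by
  simp_rw [mem_span_uvec, mulVec_mulVec, Matrix.ext_iff_mulVec]

theorem Qmat_mulVec_uvec : Qmat n *ᵥ uvec n = 0 := by
  rw [Qmat, sub_mulVec, one_mulVec, mem_span_uvec.1 (Submodule.mem_span_singleton_self _),
    sub_self]

end Projections

section Graph

variable {n : ℕ} {A B M : Matrix (Fin n) (Fin n) ℝ}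

/-- The invariance equation for graphs over `Nhyp n`, rewritten as an affine relation between the
two slopes. -/
theorem mul_graph_eq_iff (hM : ∀ i, ∑ j, M i j = 1) (hA : Pmat n * A = A) :
    (∀ v ∈ Nhyp n, M *ᵥ (A *ᵥ v + v) =
      B *ᵥ ((Qmat n * M * Qmat n) *ᵥ v) + (Qmat n * M * Qmat n) *ᵥ v) ↔
    A * Qmat n = B * (Qmat n * M * Qmat n) - Pmat n * M * Qmat n := by
  have hMA : M * A = A := by rw [← hA, ← mul_assoc, mul_Pmat hM]
  have hMQ : Qmat n * M * Qmat n = M * Qmat n - Pmat n * M * Qmat n := by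
    nth_rw 1 [Qmat]
    rw [sub_mul, one_mul, sub_mul]
  have hiff : A * Qmat n = B * (Qmat n * M * Qmat n) - Pmat n * M * Qmat n ↔
      (A + M) * Qmat n = (B + 1) * (Qmat n * M * Qmat n) := by
    rw [add_mul, add_mul, one_mul]
    nth_rw 3 [hMQ]
    constructor
    · intro h; rw [h]; abel
    · intro h; rw [eq_sub_of_add_eq h]; abel
  have hvec : ∀ v, M *ᵥ (A *ᵥ v + v) =
      B *ᵥ ((Qmat n * M * Qmat n) *ᵥ v) + (Qmat n * M * Qmat n) *ᵥ v ↔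
      (A + M) *ᵥ v = ((B + 1) * (Qmat n * M * Qmat n)) *ᵥ v := by
    intro v
    rw [mulVec_add, mulVec_mulVec, hMA, add_mul, one_mul, add_mulVec, add_mulVec, mulVec_mulVec]
  simp_rw [hvec]
  rw [hiff, Matrix.ext_iff_mulVec]
  constructor
  · intro h v
    have := h _ (Qmat_mulVec_mem_Nhyp v)
    rwa [mulVec_mulVec, mulVec_mulVec, mul_assoc (B + 1), compression_mul_Qmat] at this
  · intro h v hv
    rw [← h v, ← mulVec_mulVec, mem_Nhyp.1 hv]

theorem Qmat_mul_graph (hA : Pmat n * A = A) : Qmat n * (A + 1) * Qmat n = Qmat n := by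
  have : Qmat n * A = 0 := by rw [← hA, ← mul_assoc, Qmat_mul_Pmat, zero_mul]
  rw [mul_add, this, zero_add, mul_one, Qmat_mul_self]

theorem mem_graph_iff (hA : Pmat n * A = A) {w : Fin n → ℝ} :
    w ∈ (Nhyp n).map (mulVecLin (A + 1)) ↔ (A + 1) *ᵥ (Qmat n *ᵥ w) = w := by
  constructor
  · rintro ⟨v, hv, rfl⟩
    rw [mulVecLin_apply]
    nth_rw 1 [← mem_Nhyp.1 hv]
    rw [mulVec_mulVec v (A + 1), mulVec_mulVec v (Qmat n), ← mul_assoc, Qmat_mul_graph hA,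
      mem_Nhyp.1 hv]
  · intro h
    exact ⟨_, Qmat_mulVec_mem_Nhyp w, h⟩

theorem isCompl_span_uvec_graph (hA : Pmat n * A = A) :
    IsCompl (Submodule.span ℝ {uvec n}) ((Nhyp n).map (mulVecLin (A + 1))) := by
  refine IsCompl.of_eq (Submodule.eq_bot_iff _ |>.2 ?_) (Submodule.eq_top_iff'.2 fun w => ?_)
  · rintro w ⟨h1, h2⟩
    rw [← (mem_graph_iff hA).1 h2, ← mem_span_uvec.1 h1, mulVec_mulVec w (Qmat n), Qmat_mul_Pmat,
      zero_mulVec, mulVec_zero]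
  · have hw : w = (Pmat n *ᵥ w - A *ᵥ (Qmat n *ᵥ w)) + (A + 1) *ᵥ (Qmat n *ᵥ w) := by
      rw [add_mulVec, one_mulVec, ← add_assoc, sub_add_cancel, ← add_mulVec, Qmat,
        add_sub_cancel, one_mulVec]
    rw [hw]
    refine Submodule.add_mem_sup (Submodule.sub_mem _ ?_ (Pmat_mul_eq_self_iff.1 hA _))
      (Submodule.mem_map_of_mem (Qmat_mulVec_mem_Nhyp w))
    rw [mem_span_uvec, mulVec_mulVec, Pmat_mul_self]

theorem finrank_graph (hA : Pmat n * A = A) :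
    Module.finrank ℝ ((Nhyp n).map (mulVecLin (A + 1))) = n - 1 := by
  have h := Submodule.finrank_add_eq_of_isCompl (isCompl_span_uvec_graph hA)
  rw [Module.finrank_fin_fun] at h
  rcases Nat.eq_zero_or_pos n with rfl | hn
  · omega
  have hu : uvec n ≠ 0 := fun h0 => by
    have := congrFun h0 ⟨0, hn⟩
    simp [uvec, hn.ne'] at this
  rw [finrank_span_singleton hu] at h
  omega

theorem cocycle_mul_graph {X : Type*} {f : X → X} {S σ : X → Matrix (Fin n) (Fin n) ℝ}
    (h : ∀ x, S x * (σ x + 1) * Qmat n = (σ (f x) + 1) * (Qmat n * S x * Qmat n))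
    (k : ℕ) (x : X) :
    cocycle f S k x * (σ x + 1) * Qmat n =
      (σ (f^[k] x) + 1) * Qmat n * cocycle f (fun y => Qmat n * S y * Qmat n) k x * Qmat n := by
  induction k with
  | zero => simp [cocycle, mul_assoc, Qmat_mul_self]
  | succ k ih =>
    rw [cocycle, cocycle, Function.iterate_succ_apply', mul_assoc (S _), mul_assoc (S _), ih,
      ← mul_assoc, ← mul_assoc, ← mul_assoc, h, ← mul_assoc (_ * Qmat n), mul_assoc _ (Qmat n),
      Qmat_mul_compression]

end Graph

section Norm

open scoped Matrix.Norms.L2Operator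

variable {n : ℕ}

theorem opNorm_eq_norm (A : Matrix (Fin n) (Fin n) ℝ) : opNorm A = ‖A‖ := rfl

theorem norm_cocycle_mul_le {X : Type*} {f : X → X} {T : X → Matrix (Fin n) (Fin n) ℝ} {ρ : ℝ}
    (hT : ∀ x, ‖T x‖ ≤ ρ) (B : Matrix (Fin n) (Fin n) ℝ) (k : ℕ) (x : X) :
    ‖cocycle f T k x * B‖ ≤ ρ ^ k * ‖B‖ := by
  have hρ : 0 ≤ ρ := (norm_nonneg _).trans (hT x)
  induction k with
  | zero => simp [cocycle]
  | succ k ih =>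
    calc ‖cocycle f T (k + 1) x * B‖ = ‖T (f^[k] x) * (cocycle f T k x * B)‖ := by
          rw [cocycle, mul_assoc]
      _ ≤ ‖T (f^[k] x)‖ * ‖cocycle f T k x * B‖ := norm_mul_le _ _
      _ ≤ ρ * (ρ ^ k * ‖B‖) := by gcongr; exact hT _
      _ = ρ ^ (k + 1) * ‖B‖ := by ring

theorem norm_toE_mulVec_le (A : Matrix (Fin n) (Fin n) ℝ) (v : Fin n → ℝ) :
    ‖toE (A *ᵥ v)‖ ≤ ‖A‖ * ‖toE v‖ :=
  l2_opNorm_mulVec A (toE v)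

theorem exists_continuous_slope {Λ : Type*} [TopologicalSpace Λ] [CompactSpace Λ]
    {f : Λ → Λ} (hf : Continuous f) {S : Λ → Matrix (Fin n) (Fin n) ℝ} (hS : Continuous S)
    {ρ : ℝ} (hρ : ρ < 1) (hsup : ∀ x, ‖Qmat n * S x * Qmat n‖ ≤ ρ) :
    ∃ σ : Λ → Matrix (Fin n) (Fin n) ℝ, Continuous σ ∧ (∀ x, Pmat n * σ x = σ x) ∧
      (∀ x, σ x * Qmat n = σ x) ∧
      ∀ x, σ x = σ (f x) * (Qmat n * S x * Qmat n) - Pmat n * S x * Qmat n := by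
  obtain ⟨φ, hφ, hφe⟩ := exists_continuous_eq_comp_mul_sub hf
    (T := fun x => Qmat n * S x * Qmat n) (by fun_prop) hS hρ hsup
  refine ⟨fun x => Pmat n * φ x * Qmat n, by fun_prop, fun x => ?_, fun x => ?_, fun x => ?_⟩
  · rw [← mul_assoc, ← mul_assoc, Pmat_mul_self]
  · rw [mul_assoc, Qmat_mul_self]
  · beta_reduce
    rw [hφe x, mul_sub, sub_mul, ← mul_assoc (Pmat n), mul_assoc _ _ (Qmat n),
      compression_mul_Qmat, mul_assoc (Pmat n * _) (Qmat n), Qmat_mul_compression]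

theorem slope_unique {Λ : Type*} [TopologicalSpace Λ] [CompactSpace Λ]
    {f : Λ → Λ} {S σ τ : Λ → Matrix (Fin n) (Fin n) ℝ}
    (hσ : Continuous σ) (hτ : Continuous τ)
    {ρ : ℝ} (hρ : ρ < 1) (hsup : ∀ x, ‖Qmat n * S x * Qmat n‖ ≤ ρ)
    (hσe : ∀ x, σ x * Qmat n = σ (f x) * (Qmat n * S x * Qmat n) - Pmat n * S x * Qmat n)
    (hτe : ∀ x, τ x * Qmat n = τ (f x) * (Qmat n * S x * Qmat n) - Pmat n * S x * Qmat n)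
    (x : Λ) : σ x * Qmat n = τ x * Qmat n := by
  have hc : Continuous fun x => σ x * Qmat n - τ x * Qmat n := by fun_prop
  obtain ⟨M, hM⟩ := isCompact_univ.exists_bound_of_continuousOn hc.continuousOn
  refine sub_eq_zero.1 (eq_zero_of_eq_comp_mul (f := f) (δ := fun x => σ x * Qmat n - τ x * Qmat n)
    hρ hsup (fun x => hM x trivial) (fun x => ?_) x)
  rw [sub_mul, mul_assoc, mul_assoc (τ (f x)), Qmat_mul_compression, hσe, hτe, sub_sub_sub_cancel_right]

theorem exists_contraction_bound {Λ : Type*} [TopologicalSpace Λ] [CompactSpace Λ]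
    {f : Λ → Λ} {S σ : Λ → Matrix (Fin n) (Fin n) ℝ} (hσ : Continuous σ)
    {ρ : ℝ} (hsup : ∀ x, ‖Qmat n * S x * Qmat n‖ ≤ ρ) (hP : ∀ x, Pmat n * σ x = σ x)
    (h : ∀ x, S x * (σ x + 1) * Qmat n = (σ (f x) + 1) * (Qmat n * S x * Qmat n)) :
    ∃ C : ℝ, 1 ≤ C ∧ ∀ x, ∀ k : ℕ, ∀ w ∈ (Nhyp n).map (mulVecLin (σ x + 1)),
      ‖toE (cocycle f S k x *ᵥ w)‖ ≤ C * ρ ^ k * ‖toE w‖ := by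
  have hc : Continuous fun x => (σ x + 1) * Qmat n := by fun_prop
  obtain ⟨M, hM⟩ := isCompact_univ.exists_bound_of_continuousOn hc.continuousOn
  refine ⟨max 1 (M * ‖Qmat n‖), le_max_left _ _, fun x k w hw => ?_⟩
  have hρ0 : 0 ≤ ρ := (norm_nonneg _).trans (hsup x)
  have hM0 : 0 ≤ M := (norm_nonneg _).trans (hM x trivial)
  have hbound : ‖cocycle f S k x * (σ x + 1) * Qmat n‖ ≤ max 1 (M * ‖Qmat n‖) * ρ ^ k := by
    rw [cocycle_mul_graph h, mul_assoc]
    calc _ ≤ ‖(σ (f^[k] x) + 1) * Qmat n‖ *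
            ‖cocycle f (fun y => Qmat n * S y * Qmat n) k x * Qmat n‖ := norm_mul_le _ _
      _ ≤ M * (ρ ^ k * ‖Qmat n‖) := by
          gcongr
          · exact hM _ trivial
          · exact norm_cocycle_mul_le hsup _ _ _
      _ = M * ‖Qmat n‖ * ρ ^ k := by ring
      _ ≤ _ := by gcongr; exact le_max_right _ _
  have hw' : cocycle f S k x *ᵥ w = (cocycle f S k x * (σ x + 1) * Qmat n) *ᵥ w := by
    rw [← mulVec_mulVec, ← mulVec_mulVec, (mem_graph_iff (hP x)).1 hw]
  rw [hw']
  exact (norm_toE_mulVec_le _ _).trans (by gcongr)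

end Norm

/-- If `sup_x ‖Q S_x Q‖ ≤ ρ < 1`, then there is a unique continuous family of
linear maps `σ_x : N → ℝu` with `S_x(σ_x v + v) = σ_{f(x)}(Ŝ_x v) + Ŝ_x v` on `N`
(uniqueness as maps on `N`; here `σ` is realized by matrices mapping into `ℝu` and
vanishing on `u`). The graphs `F²_x = {σ_x v + v : v ∈ N}` have dimension `n − 1`,
are complementary to `ℝu`, are `S`-invariant, and are uniformly contracted at rate `ρ`. -/
theorem stmt3 {n : ℕ} {Λ : Type*} [MetricSpace Λ] [CompactSpace Λ]
    (f : Λ ≃ₜ Λ) (S : Λ → Matrix (Fin n) (Fin n) ℝ) (hScont : Continuous S)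
    (hS : ∀ x, IsStochastic (S x)) (ρ : ℝ) (hρ : ρ < 1)
    (hsup : ∀ x, opNorm (Qmat n * S x * Qmat n) ≤ ρ) :
    ∃ σ : Λ → Matrix (Fin n) (Fin n) ℝ,
      (Continuous σ ∧
        (∀ x, ∀ v, (σ x).mulVec v ∈ Submodule.span ℝ {uvec n}) ∧
        (∀ x, (σ x).mulVec (uvec n) = 0) ∧
        (∀ x, ∀ v ∈ Nhyp n, (S x).mulVec ((σ x).mulVec v + v) =
          (σ (f x)).mulVec ((Qmat n * S x * Qmat n).mulVec v)
            + (Qmat n * S x * Qmat n).mulVec v)) ∧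
      (∀ σ' : Λ → Matrix (Fin n) (Fin n) ℝ,
        (Continuous σ' ∧
          (∀ x, ∀ v, (σ' x).mulVec v ∈ Submodule.span ℝ {uvec n}) ∧
          (∀ x, (σ' x).mulVec (uvec n) = 0) ∧
          (∀ x, ∀ v ∈ Nhyp n, (S x).mulVec ((σ' x).mulVec v + v) =
            (σ' (f x)).mulVec ((Qmat n * S x * Qmat n).mulVec v)
              + (Qmat n * S x * Qmat n).mulVec v)) →
        ∀ x, ∀ v ∈ Nhyp n, (σ' x).mulVec v = (σ x).mulVec v) ∧
      (∀ x, Module.finrank ℝ ((Nhyp n).map (Matrix.mulVecLin (σ x + 1))) = n - 1) ∧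
      (∀ x, IsCompl (Submodule.span ℝ {uvec n})
          ((Nhyp n).map (Matrix.mulVecLin (σ x + 1)))) ∧
      (∀ x, ((Nhyp n).map (Matrix.mulVecLin (σ x + 1))).map (Matrix.mulVecLin (S x)) ≤
          (Nhyp n).map (Matrix.mulVecLin (σ (f x) + 1))) ∧
      (∃ C : ℝ, 1 ≤ C ∧ ∀ x, ∀ k : ℕ, ∀ w ∈ (Nhyp n).map (Matrix.mulVecLin (σ x + 1)),
        ‖toE ((cocycle (⇑f) S k x).mulVec w)‖ ≤ C * ρ ^ k * ‖toE w‖) := by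
  obtain ⟨σ, hσ, hP, hQ, hσe⟩ := exists_continuous_slope f.continuous hScont hρ hsup
  have hσe' : ∀ x, σ x * Qmat n =
      σ (f x) * (Qmat n * S x * Qmat n) - Pmat n * S x * Qmat n := fun x => (hQ x).trans (hσe x)
  have heq := fun x => (mul_graph_eq_iff (B := σ (f x)) (hS x).2 (hP x)).2 (hσe' x)
  have hgraph : ∀ x, S x * (σ x + 1) * Qmat n = (σ (f x) + 1) * (Qmat n * S x * Qmat n) := by
    intro x
    refine Matrix.ext_iff_mulVec.2 fun v => ?_
    have h := heq x _ (Qmat_mulVec_mem_Nhyp v)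
    rw [mulVec_mulVec v (Qmat n * S x * Qmat n), compression_mul_Qmat] at h
    rw [← mulVec_mulVec, ← mulVec_mulVec, ← mulVec_mulVec, add_mulVec, add_mulVec, one_mulVec,
      one_mulVec, h]
  refine ⟨σ, ⟨hσ, fun x => Pmat_mul_eq_self_iff.1 (hP x), fun x => ?_, heq⟩, ?_,
    fun x => finrank_graph (hP x), fun x => isCompl_span_uvec_graph (hP x), ?_,
    exists_contraction_bound hσ hsup hP hgraph⟩
  · rw [← hQ x, ← mulVec_mulVec, Qmat_mulVec_uvec, mulVec_zero]
  · rintro τ ⟨hτ, hτP, -, hτe⟩ x v hv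
    have h := slope_unique hτ hσ hρ hsup
      (fun x => (mul_graph_eq_iff (hS x).2 (Pmat_mul_eq_self_iff.2 (hτP x))).1 (hτe x)) hσe' x
    rw [← mem_Nhyp.1 hv, mulVec_mulVec, mulVec_mulVec, h]
  · rintro x _ ⟨_, ⟨v, hv, rfl⟩, rfl⟩
    refine ⟨(Qmat n * S x * Qmat n) *ᵥ v, ?_, ?_⟩
    · rw [mul_assoc, ← mulVec_mulVec]
      exact Qmat_mulVec_mem_Nhyp _
    · simp only [mulVecLin_apply, add_mulVec, one_mulVec]
      exact (heq x v hv).symm
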